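/- Let N be a positive integer, Λ ∈ GL(N,ℝ), and let G be a smooth harmonic-Einstein map from ℝ to the symmetric positive-definite real N×N matrices such that G and G' both satisfy the Λ-holonomy boundary condition. Let h be a smooth map from ℝ to the symmetric real N×N matrices satisfying the Λ-holonomy boundary condition, and let v : ℝ → ℝ be smooth with v(0) = v(1). Then ∫₀¹ (F h)(ξ) v(ξ) dξ = −∫₀¹ ⟨G'(ξ), h(ξ)⟩_{G(ξ)} v'(ξ) dξ. In particular, the derivative identity (d/dξ) ⟨G'(ξ), h(ξ)⟩_{G(ξ)} = (F h)(ξ) holds for all ξ. -/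

import Mathlib

open Matrix

/-- The fiberwise inner product `⟨φ,ψ⟩_G = tr(G⁻¹ φ G⁻¹ ψᵀ)`. -/
noncomputable def innerG {N : ℕ} (G φ ψ : Matrix (Fin N) (Fin N) ℝ) : ℝ :=
  (G⁻¹ * φ * G⁻¹ * ψᵀ).trace

/-- The Λ-holonomy boundary condition `φ(1) = Λᵀ φ(0) Λ`. -/
def holBC {N : ℕ} (Λ : Matrix (Fin N) (Fin N) ℝ)
    (φ : ℝ → Matrix (Fin N) (Fin N) ℝ) : Prop :=
  φ 1 = Λᵀ * φ 0 * Λ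

/-- The operator `L₂` associated to a fiber metric `G` (with derivative `G'`),
acting on `h` with derivatives `h'`, `h''`. -/
noncomputable def L2 {N : ℕ} (G G' h h' h'' : ℝ → Matrix (Fin N) (Fin N) ℝ)
    (ξ : ℝ) : Matrix (Fin N) (Fin N) ℝ :=
  h'' ξ - h' ξ * (G ξ)⁻¹ * G' ξ - G' ξ * (G ξ)⁻¹ * h' ξ
    + G' ξ * (G ξ)⁻¹ * h ξ * (G ξ)⁻¹ * G' ξ

/-- The coupling term `(F h)(ξ) = ⟨G'(ξ), h'(ξ)⟩_{G(ξ)} − ⟨G''(ξ), h(ξ)⟩_{G(ξ)}`. -/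
noncomputable def Fop {N : ℕ} (G G' G'' h h' : ℝ → Matrix (Fin N) (Fin N) ℝ)
    (ξ : ℝ) : ℝ :=
  innerG (G ξ) (G' ξ) (h' ξ) - innerG (G ξ) (G'' ξ) (h ξ)

section MatrixCalculus

open scoped Matrix.Norms.Operator

variable {n : Type*} [Fintype n]

/-- A matrix-valued curve is differentiable as soon as its entries are. -/
theorem hasDerivAt_matrix_of_entries {A : ℝ → Matrix n n ℝ} {A' : Matrix n n ℝ} {x : ℝ}
    (hA : ∀ i j, HasDerivAt (fun t => A t i j) (A' i j) x) : HasDerivAt A A' x :=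
  hasDerivAt_pi.2 fun i => hasDerivAt_pi.2 fun j => hA i j

/-- Derivative of the inverse along a curve of invertible matrices. -/
theorem HasDerivAt.matrix_inv [DecidableEq n] {A : ℝ → Matrix n n ℝ} {A' : Matrix n n ℝ}
    {x : ℝ} (hA : HasDerivAt A A' x) (hx : IsUnit (A x)) :
    HasDerivAt (fun t => (A t)⁻¹) (-((A x)⁻¹ * A' * (A x)⁻¹)) x := by
  obtain ⟨u, hu⟩ := hx
  have hinv : HasFDerivAt Ring.inverse
      (-ContinuousLinearMap.mulLeftRight ℝ (Matrix n n ℝ) ↑u⁻¹ ↑u⁻¹) (A x) :=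
    hu ▸ hasFDerivAt_ringInverse u
  have hcomp := hinv.comp_hasDerivAt x hA
  simp_rw [nonsing_inv_eq_ringInverse]
  rw [← hu, Ring.inverse_unit]
  exact hcomp.congr_deriv (by simp)

theorem HasDerivAt.matrix_transpose {A : ℝ → Matrix n n ℝ} {A' : Matrix n n ℝ} {x : ℝ}
    (hA : HasDerivAt A A' x) : HasDerivAt (fun t => (A t)ᵀ) A'ᵀ x :=
  hasDerivAt_matrix_of_entries fun i j => hasDerivAt_pi.1 (hasDerivAt_pi.1 hA j) i

theorem HasDerivAt.matrix_trace {A : ℝ → Matrix n n ℝ} {A' : Matrix n n ℝ} {x : ℝ}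
    (hA : HasDerivAt A A' x) : HasDerivAt (fun t => (A t).trace) A'.trace x :=
  HasDerivAt.fun_sum fun i _ => hasDerivAt_pi.1 (hasDerivAt_pi.1 hA i) i

variable {N : ℕ}

theorem hasDerivAt_innerG {G φ ψ : ℝ → Matrix (Fin N) (Fin N) ℝ}
    {G' φ' ψ' : Matrix (Fin N) (Fin N) ℝ} {x : ℝ} (hG : HasDerivAt G G' x)
    (hφ : HasDerivAt φ φ' x) (hψ : HasDerivAt ψ ψ' x) (hx : IsUnit (G x)) :
    HasDerivAt (fun t => innerG (G t) (φ t) (ψ t))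
      (innerG (G x) (φ x) ψ' + innerG (G x) φ' (ψ x)
        - innerG (G x) (G' * (G x)⁻¹ * φ x) (ψ x)
        - innerG (G x) (φ x * (G x)⁻¹ * G') (ψ x)) x := by
  have hinv := hG.matrix_inv hx
  have htrace := (((hinv.fun_mul hφ).fun_mul hinv).fun_mul hψ.matrix_transpose).matrix_trace
  refine htrace.congr_deriv ?_
  simp only [innerG, ← trace_add, ← trace_sub]
  congr 1
  noncomm_ring

theorem continuous_innerG {G φ ψ : ℝ → Matrix (Fin N) (Fin N) ℝ}
    (hG : Continuous fun t => (G t)⁻¹) (hφ : Continuous φ) (hψ : Continuous ψ) :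
    Continuous fun t => innerG (G t) (φ t) (ψ t) :=
  (((hG.matrix_mul hφ).matrix_mul hG).matrix_mul hψ.matrix_transpose).matrix_trace

theorem continuous_matrix_inv [DecidableEq n] {A : ℝ → Matrix n n ℝ} (hA : Continuous A)
    (hunit : ∀ t, IsUnit (A t)) : Continuous fun t => (A t)⁻¹ := by
  simp_rw [nonsing_inv_eq_ringInverse]
  refine continuous_iff_continuousAt.2 fun t => ?_
  obtain ⟨u, hu⟩ := hunit t
  have hinv : ContinuousAt Ring.inverse (A t) := hu ▸ NormedRing.inverse_continuousAt u
  exact hinv.comp hA.continuousAt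

end MatrixCalculus

/-- The fiberwise inner product is invariant under simultaneous congruence. -/
theorem innerG_congruence {N : ℕ} {Λ : Matrix (Fin N) (Fin N) ℝ} (hΛ : IsUnit Λ)
    (G φ ψ : Matrix (Fin N) (Fin N) ℝ) :
    innerG (Λᵀ * G * Λ) (Λᵀ * φ * Λ) (Λᵀ * ψ * Λ) = innerG G φ ψ := by
  have hdet : IsUnit Λ.det := (isUnit_iff_isUnit_det Λ).1 hΛ
  have hdetT : IsUnit Λᵀ.det := isUnit_det_transpose Λ hdet
  have hconj : (Λᵀ * G * Λ)⁻¹ * (Λᵀ * φ * Λ) * (Λᵀ * G * Λ)⁻¹ * (Λᵀ * ψ * Λ)ᵀ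
      = Λ⁻¹ * ((G⁻¹ * φ * G⁻¹ * ψᵀ) * Λ) := by
    simp only [Matrix.mul_inv_rev, transpose_mul, transpose_transpose, Matrix.mul_assoc,
      nonsing_inv_mul_cancel_left _ _ hdetT, mul_nonsing_inv_cancel_left _ _ hdet]
  rw [innerG, innerG, hconj, trace_mul_comm, Matrix.mul_assoc, mul_nonsing_inv _ hdet,
    Matrix.mul_one]

theorem continuous_of_hasDerivAt_of_contDiff {f f' : ℝ → ℝ} (hf : ContDiff ℝ (⊤ : ℕ∞) f)
    (hderiv : ∀ t, HasDerivAt f (f' t) t) : Continuous f' := by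
  rw [← funext fun t => (hderiv t).deriv]
  exact hf.continuous_deriv (by exact_mod_cast le_top)

theorem Fop_integration_by_parts {N : ℕ} (hN : 0 < N)
    (Λ : Matrix (Fin N) (Fin N) ℝ) (hΛ : IsUnit Λ)
    (G G' G'' h h' : ℝ → Matrix (Fin N) (Fin N) ℝ)
    (hGsmooth : ∀ i j, ContDiff ℝ (⊤ : ℕ∞) fun ξ => G ξ i j)
    (hGderiv : ∀ ξ i j, HasDerivAt (fun t => G t i j) (G' ξ i j) ξ)
    (hGderiv2 : ∀ ξ i j, HasDerivAt (fun t => G' t i j) (G'' ξ i j) ξ)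
    (hGpos : ∀ ξ, (G ξ).PosDef)
    (hHE : ∀ ξ, G'' ξ = G' ξ * (G ξ)⁻¹ * G' ξ)
    (hGbc : holBC Λ G) (hG'bc : holBC Λ G')
    (hhsmooth : ∀ i j, ContDiff ℝ (⊤ : ℕ∞) fun ξ => h ξ i j)
    (hhderiv : ∀ ξ i j, HasDerivAt (fun t => h t i j) (h' ξ i j) ξ)
    (hhsymm : ∀ ξ, (h ξ).IsSymm)
    (hhbc : holBC Λ h)
    (v v' : ℝ → ℝ)
    (hvsmooth : ContDiff ℝ (⊤ : ℕ∞) v)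
    (hvderiv : ∀ ξ, HasDerivAt v (v' ξ) ξ)
    (hvbc : v 0 = v 1) :
    ((∫ ξ in (0:ℝ)..1, Fop G G' G'' h h' ξ * v ξ) =
        -(∫ ξ in (0:ℝ)..1, innerG (G ξ) (G' ξ) (h ξ) * v' ξ)) ∧
      ∀ ξ : ℝ, HasDerivAt (fun t => innerG (G t) (G' t) (h t))
        (Fop G G' G'' h h' ξ) ξ := by
  have hunit : ∀ ξ, IsUnit (G ξ) := fun ξ => (hGpos ξ).isUnit
  have hderiv : ∀ ξ : ℝ, HasDerivAt (fun t => innerG (G t) (G' t) (h t))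
      (Fop G G' G'' h h' ξ) ξ := fun ξ => by
    refine (hasDerivAt_innerG (hasDerivAt_matrix_of_entries (hGderiv ξ))
      (hasDerivAt_matrix_of_entries (hGderiv2 ξ))
      (hasDerivAt_matrix_of_entries (hhderiv ξ)) (hunit ξ)).congr_deriv ?_
    rw [Fop, ← hHE ξ]
    ring
  refine ⟨?_, hderiv⟩
  have hGcont : Continuous G :=
    continuous_matrix fun i j => (hGsmooth i j).continuous
  have hG'cont : Continuous G' :=
    continuous_matrix fun i j =>
      continuous_of_hasDerivAt_of_contDiff (hGsmooth i j) fun ξ => hGderiv ξ i j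
  have hhcont : Continuous h :=
    continuous_matrix fun i j => (hhsmooth i j).continuous
  have hh'cont : Continuous h' :=
    continuous_matrix fun i j =>
      continuous_of_hasDerivAt_of_contDiff (hhsmooth i j) fun ξ => hhderiv ξ i j
  have hinvcont : Continuous fun ξ => (G ξ)⁻¹ := continuous_matrix_inv hGcont hunit
  have hG''cont : Continuous G'' := by
    rw [funext hHE]
    exact (hG'cont.matrix_mul hinvcont).matrix_mul hG'cont
  have hFcont : Continuous (Fop G G' G'' h h') :=
    (continuous_innerG hinvcont hG'cont hh'cont).sub
      (continuous_innerG hinvcont hG''cont hhcont)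
  have hv'cont : Continuous v' := continuous_of_hasDerivAt_of_contDiff hvsmooth hvderiv
  have hperiodic : innerG (G 1) (G' 1) (h 1) = innerG (G 0) (G' 0) (h 0) := by
    rw [hGbc, hG'bc, hhbc, innerG_congruence hΛ]
  have hparts := intervalIntegral.integral_mul_deriv_eq_deriv_mul
    (fun ξ _ => hderiv ξ) (fun ξ _ => hvderiv ξ)
    (hFcont.intervalIntegrable 0 1) (hv'cont.intervalIntegrable 0 1)
  rw [hparts, hperiodic, hvbc]
  ring
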